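/- arXiv:1602.00144 — 3 statements merged into one kernel-verified Lean document; each statement's English description precedes it below -/
import Mathlib

section
/- Let G be a finitely generated LERF group with positive rank gradient, let n be a natural number, and let H₁, …, Hₙ be finitely generated subgroups of infinite index in G. Then the product set H₁H₂⋯Hₙ is a proper subset of G. -/
open scoped Pointwise

universe u

/-- `d(H)`: the smallest cardinality of a generating set of the subgroup `H`. -/
noncomputable def subgroupRank {G : Type u} [Group G] (H : Subgroup G) : ℕ :=
  sInf {n : ℕ | ∃ S : Finset G, S.card = n ∧ Subgroup.closure (S : Set G) = H}

/-- The rank gradient `∇G = inf (d(U) - 1)/[G : U]` over finite index subgroups `U`. -/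
noncomputable def rankGradient (G : Type u) [Group G] : ℝ :=
  sInf {r : ℝ | ∃ U : Subgroup G, U.FiniteIndex ∧
    r = ((subgroupRank U : ℝ) - 1) / (U.index : ℝ)}

/-- `G` is LERF if every finitely generated subgroup is an intersection of
finite index subgroups. -/
def IsLERF (G : Type u) [Group G] : Prop :=
  ∀ H : Subgroup G, H.FG →
    ∃ 𝒮 : Set (Subgroup G), (∀ U ∈ 𝒮, U.FiniteIndex) ∧ H = sInf 𝒮

/-- `G` is LPF if every finitely generated subgroup of infinite index is contained in
finite index subgroups of arbitrarily large index. -/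
def IsLPF (G : Type u) [Group G] : Prop :=
  ∀ H : Subgroup G, H.FG → H.index = 0 →
    ∀ n : ℕ, ∃ U : Subgroup G, H ≤ U ∧ U.FiniteIndex ∧ n ≤ U.index

/-- An epimorphism from `G` onto a finite group. -/
structure FiniteQuotient (G : Type u) [Group G] where
  K : Type u
  [grp : Group K]
  [fin : Fintype K]
  φ : G →* K
  surj : Function.Surjective φ

attribute [instance] FiniteQuotient.grp FiniteQuotient.fin

/-- The profinite measure `μ(S) = inf |φ(S)|/|φ(G)|` over epimorphisms `φ` from `G`
onto finite groups. -/
noncomputable def profiniteMeasure {G : Type u} [Group G] (S : Set G) : ℝ :=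
  sInf {r : ℝ | ∃ q : FiniteQuotient G,
    r = (Set.ncard (q.φ '' S) : ℝ) / (Fintype.card q.K : ℝ)}

/-- The product set `H₁H₂⋯Hₙ`. -/
def productSet {G : Type u} [Group G] {n : ℕ} (H : Fin n → Subgroup G) : Set G :=
  {g : G | ∃ f : Fin n → G, (∀ i, f i ∈ H i) ∧ g = (List.ofFn f).prod}

namespace RG

variable {G : Type u} [Group G]

/-- Schreier bound for `H ⊓ V` inside `H`. -/
lemma gens_inf (H V : Subgroup G) [V.FiniteIndex] (hH : H.FG) :
    ∃ T : Finset G, Subgroup.closure (T : Set G) = H ⊓ V ∧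
      T.card ≤ V.relIndex H * subgroupRank H := by
  classical
  have hne : {n : ℕ | ∃ S : Finset G, S.card = n ∧ Subgroup.closure (S : Set G) = H}.Nonempty := by
    obtain ⟨S, hS⟩ := hH
    exact ⟨S.card, S, rfl, hS⟩
  obtain ⟨S, hSc, hS⟩ := Nat.sInf_mem hne
  change S.card = subgroupRank H at hSc
  haveI : Group.FG H := (Group.fg_iff_subgroup_fg H).2 hH
  have hle : Group.rank H ≤ S.card := by
    subst hS
    exact Subgroup.rank_closure_finset_le_card S
  have h1 := Subgroup.rank_le_index_mul_rank (V.subgroupOf H)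
  obtain ⟨T, hTc, hT⟩ := Group.rank_spec (V.subgroupOf H)
  refine ⟨T.image (H.subtype.comp (V.subgroupOf H).subtype), ?_, ?_⟩
  · rw [Finset.coe_image, ← MonoidHom.map_closure, hT, ← Subgroup.map_map,
      ← MonoidHom.range_eq_map, Subgroup.range_subtype, Subgroup.subgroupOf_map_subtype, inf_comm]
  · have h2 : (T.image (H.subtype.comp (V.subgroupOf H).subtype)).card ≤ T.card :=
      Finset.card_image_le
    have h3 : (V.subgroupOf H).index * Group.rank H ≤ V.relIndex H * subgroupRank H :=
      Nat.mul_le_mul_left _ (hSc ▸ hle)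
    omega

lemma gradient_le (hpos : 0 < rankGradient G) (U : Subgroup G) (hU : U.FiniteIndex)
    (S : Finset G) (hS : Subgroup.closure (S : Set G) = U) :
    rankGradient G * U.index ≤ (S.card : ℝ) - 1 := by
  have hi : (1 : ℝ) ≤ U.index := by
    exact_mod_cast Nat.one_le_iff_ne_zero.2 hU.index_ne_zero
  have h1 : rankGradient G ≤ ((subgroupRank U : ℝ) - 1) / (U.index : ℝ) := by
    apply csInf_le
    · refine ⟨-1, ?_⟩
      rintro r ⟨W, hW, rfl⟩
      have hi : (1 : ℝ) ≤ W.index := by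
        exact_mod_cast Nat.one_le_iff_ne_zero.2 hW.index_ne_zero
      rw [le_div_iff₀ (by linarith)]
      have : (0 : ℝ) ≤ subgroupRank W := Nat.cast_nonneg _
      linarith
    · exact ⟨U, hU, rfl⟩
  rw [le_div_iff₀ (by linarith)] at h1
  have h2 : subgroupRank U ≤ S.card := Nat.sInf_le ⟨S, rfl, hS⟩
  have h3 : (subgroupRank U : ℝ) ≤ S.card := by exact_mod_cast h2
  linarith

lemma lpf (hlerf : IsLERF G) : IsLPF G := by
  intro H hH hi n
  by_contra! hcon
  obtain ⟨𝒮, hfin, hHS⟩ := hlerf H hH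
  -- take an overgroup of maximal index
  let P : ℕ → Prop := fun k => ∃ W : Subgroup G, H ≤ W ∧ W.FiniteIndex ∧ W.index = k
  classical
  have hP : P (Nat.findGreatest P n) := by
    refine Nat.findGreatest_spec (m := 1) ?_ ?_
    · have := hcon ⊤ le_top inferInstance
      simp at this
      omega
    · exact ⟨⊤, le_top, inferInstance, Subgroup.index_top⟩
  obtain ⟨W, hHW, hWf, hWi⟩ := hP
  have hWH : W ≤ H := by
    rw [hHS]
    refine le_sInf fun U hU => ?_
    haveI := hfin U hU
    have hHU : H ≤ U := hHS ▸ sInf_le hU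
    have hf : (W ⊓ U).FiniteIndex := inferInstance
    have h1 : (W ⊓ U).index ≤ W.index := by
      rw [hWi]
      exact Nat.le_findGreatest (hcon _ (le_inf hHW hHU) hf).le
        ⟨_, le_inf hHW hHU, hf, rfl⟩
    have h2 := Subgroup.relIndex_mul_index (inf_le_left : W ⊓ U ≤ W)
    have h3 : (W ⊓ U).relIndex W = 1 := by
      have hW0 := Nat.pos_of_ne_zero hWf.index_ne_zero
      have h0 := hf.index_ne_zero
      have : (W ⊓ U).relIndex W ≠ 0 := by
        intro h; rw [h, zero_mul] at h2; exact h0 h2.symm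
      have : (W ⊓ U).relIndex W ≤ 1 := by
        by_contra! h
        nlinarith
      omega
    rw [Subgroup.relIndex_eq_one] at h3
    exact h3.trans inf_le_right
  exact hWf.index_ne_zero (le_antisymm hWH hHW ▸ hi)

/-- `A` is covered by finitely many left cosets of f.g. subgroups of infinite index. -/
def Cov (A : Set G) : Prop :=
  ∃ F : Set (G × Subgroup G), F.Finite ∧ (∀ p ∈ F, p.2.FG ∧ p.2.index = 0) ∧
    ∀ a ∈ A, ∃ p ∈ F, p.1⁻¹ * a ∈ p.2

lemma Cov.biUnion {ι : Type*} {T : Set ι} (hT : T.Finite) {B : ι → Set G}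
    (hB : ∀ i ∈ T, Cov (B i)) {A : Set G} (hA : ∀ a ∈ A, ∃ i ∈ T, a ∈ B i) : Cov A := by
  choose! F hF h1 h2 using hB
  refine ⟨⋃ i ∈ T, F i, hT.biUnion hF, ?_, ?_⟩
  · intro p hp
    simp only [Set.mem_iUnion] at hp
    obtain ⟨i, hi, hp⟩ := hp
    exact h1 i hi p hp
  · intro a ha
    obtain ⟨i, hi, hai⟩ := hA a ha
    obtain ⟨p, hp, hpa⟩ := h2 i hi a hai
    exact ⟨p, by simp only [Set.mem_iUnion]; exact ⟨i, hi, hp⟩, hpa⟩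

/-- the two-sided translate `s L t` is a coset -/
lemma cov_translate (L : Subgroup G) (hL : L.FG) (hi : L.index = 0) (s t : G) :
    Cov {x : G | s⁻¹ * x * t⁻¹ ∈ L} := by
  refine ⟨{(s * t, L.map (MulAut.conj t⁻¹).toMonoidHom)}, Set.finite_singleton _, ?_, ?_⟩
  · rintro p rfl
    classical
    refine ⟨?_, ?_⟩
    · obtain ⟨S, hS⟩ := hL
      refine ⟨S.image (MulAut.conj t⁻¹).toMonoidHom, ?_⟩
      rw [Finset.coe_image, ← MonoidHom.map_closure, hS]
    rw [← hi]
    exact Subgroup.index_map_equiv L (MulAut.conj t⁻¹)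
  · intro a ha
    refine ⟨_, rfl, ?_⟩
    refine ⟨s⁻¹ * a * t⁻¹, ha, ?_⟩
    simp [mul_assoc]

lemma exists_reps (H V : Subgroup G) [V.FiniteIndex] :
    ∃ T : Set G, T.Finite ∧ (∀ t ∈ T, t ∈ H) ∧ ∀ h ∈ H, ∃ t ∈ T, t⁻¹ * h ∈ V := by
  refine ⟨Set.range fun q : H ⧸ V.subgroupOf H => ((q.out : H) : G), Set.finite_range _, ?_, ?_⟩
  · rintro t ⟨q, rfl⟩
    exact q.out.2
  · intro h hh
    refine ⟨_, ⟨((⟨h, hh⟩ : H) : H ⧸ V.subgroupOf H), rfl⟩, ?_⟩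
    have := QuotientGroup.eq.1 (Quotient.out_eq ((⟨h, hh⟩ : H) : H ⧸ V.subgroupOf H))
    simpa [Subgroup.mem_subgroupOf] using this

lemma cov_two (hlerf : IsLERF G) (hpos : 0 < rankGradient G) (H K : Subgroup G)
    (hH : H.FG) (hK : K.FG) (hHi : H.index = 0) (hKi : K.index = 0) :
    Cov {x : G | ∃ h ∈ H, ∃ k ∈ K, x = h * k} := by
  classical
  obtain ⟨m, hm⟩ := exists_nat_gt (((subgroupRank H : ℝ) + 1) / rankGradient G)
  obtain ⟨U, hHU, hUf, hUm⟩ := lpf hlerf H hH hHi m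
  obtain ⟨S, hS, -⟩ := gens_inf K U hK
  have hKU : (K ⊓ U).FG := ⟨S, hS⟩
  have hKUi : (K ⊓ U).index = 0 := Nat.eq_zero_of_zero_dvd
    (hKi ▸ Subgroup.index_dvd_of_le (inf_le_left : K ⊓ U ≤ K))
  obtain ⟨V', hKV', hVf', hVm⟩ := lpf hlerf (K ⊓ U) hKU hKUi (S.card * U.index)
  obtain ⟨V, hV⟩ : ∃ V, V = V' ⊓ U := ⟨_, rfl⟩
  have hVU : V ≤ U := hV ▸ inf_le_right
  have hVV' : V ≤ V' := hV ▸ inf_le_left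
  have hKV : K ⊓ U ≤ V := hV ▸ le_inf hKV' inf_le_right
  haveI hVf : V.FiniteIndex := hV ▸ inferInstance
  obtain ⟨T, hT, hTc⟩ := gens_inf H V hH
  have hmul := Subgroup.relIndex_mul_index hVU
  have hU0 : 0 < U.index := Nat.pos_of_ne_zero hUf.index_ne_zero
  have hrel0 : V.relIndex U ≠ 0 := by
    intro h; rw [h, zero_mul] at hmul; exact hVf.index_ne_zero hmul.symm
  have hrel : S.card ≤ V.relIndex U := by
    have : V'.index ≤ V.index := Nat.le_of_dvd (Nat.pos_of_ne_zero hVf.index_ne_zero)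
      (Subgroup.index_dvd_of_le hVV')
    have h : S.card * U.index ≤ V.relIndex U * U.index := by omega
    exact Nat.le_of_mul_le_mul_right h hU0
  have hTc' : T.card ≤ V.relIndex U * subgroupRank H :=
    hTc.trans (Nat.mul_le_mul_right _ (Subgroup.relIndex_le_of_le_right hHU hrel0))
  obtain ⟨L, hL⟩ : ∃ L, L = Subgroup.closure ((T ∪ S : Finset G) : Set G) := ⟨_, rfl⟩
  have hL' : L = (H ⊓ V) ⊔ (K ⊓ U) := by
    rw [hL, Finset.coe_union, Subgroup.closure_union, hT, hS]
  have hLV : L ≤ V := hL' ▸ sup_le inf_le_right hKV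
  have hLfg : L.FG := ⟨_, hL.symm⟩
  have hLi : L.index = 0 := by
    by_contra hne
    have h1 := gradient_le hpos L ⟨hne⟩ _ hL.symm
    have h2 : V.index ≤ L.index := Nat.le_of_dvd (Nat.pos_of_ne_zero hne)
      (Subgroup.index_dvd_of_le hLV)
    have h3 : (T ∪ S).card ≤ V.relIndex U * subgroupRank H + V.relIndex U :=
      (Finset.card_union_le _ _).trans (add_le_add hTc' hrel)
    have h3' : ((T ∪ S).card : ℝ) ≤ V.relIndex U * (subgroupRank H + 1) := by
      have : ((T ∪ S).card : ℝ) ≤ V.relIndex U * subgroupRank H + V.relIndex U := by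
        exact_mod_cast h3
      linarith
    have h4 : (V.relIndex U : ℝ) * U.index ≤ L.index := by
      rw [← hmul] at h2
      exact_mod_cast h2
    have h5 : (subgroupRank H : ℝ) + 1 ≤ U.index * rankGradient G := by
      rw [div_lt_iff₀ hpos] at hm
      have : (m : ℝ) ≤ U.index := by exact_mod_cast hUm
      nlinarith
    have h6 : (V.relIndex U : ℝ) * (subgroupRank H + 1)
        ≤ V.relIndex U * (U.index * rankGradient G) :=
      mul_le_mul_of_nonneg_left h5 (Nat.cast_nonneg _)
    have h7 := mul_le_mul_of_nonneg_left h4 hpos.le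
    linarith
  obtain ⟨A, hAf, hAH, hA⟩ := exists_reps H V
  obtain ⟨B, hBf, hBK, hB⟩ := exists_reps K U
  refine Cov.biUnion (hAf.prod hBf) (B := fun p => {x : G | p.1⁻¹ * x * (p.2⁻¹)⁻¹ ∈ L})
    (fun p _ => cov_translate L hLfg hLi _ _) ?_
  rintro _ ⟨h, hh, k, hk, rfl⟩
  obtain ⟨a, ha, hah⟩ := hA h hh
  obtain ⟨b, hb, hbk⟩ := hB k⁻¹ (K.inv_mem hk)
  refine ⟨(a, b), ⟨ha, hb⟩, ?_⟩
  have e : a⁻¹ * (h * k) * (b⁻¹)⁻¹ = (a⁻¹ * h) * (b⁻¹ * k⁻¹)⁻¹ := by group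
  change a⁻¹ * (h * k) * (b⁻¹)⁻¹ ∈ L
  rw [e, hL']
  refine mul_mem ((le_sup_left : H ⊓ V ≤ _) ⟨?_, hah⟩)
    (inv_mem ((le_sup_right : K ⊓ U ≤ _) ⟨?_, hbk⟩))
  · exact H.mul_mem (H.inv_mem (hAH a ha)) hh
  · exact K.mul_mem (K.inv_mem (hBK b hb)) (K.inv_mem hk)

lemma Cov.mul (hlerf : IsLERF G) (hpos : 0 < rankGradient G) {A : Set G} (hA : Cov A)
    (K : Subgroup G) (hK : K.FG) (hKi : K.index = 0) :
    Cov {x : G | ∃ a ∈ A, ∃ k ∈ K, x = a * k} := by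
  obtain ⟨F, hF, hF1, hF2⟩ := hA
  refine Cov.biUnion hF (B := fun p => {x : G | ∃ h ∈ p.2, ∃ k ∈ K, x = p.1 * (h * k)}) ?_ ?_
  · intro p hp
    obtain ⟨E, hE, hE1, hE2⟩ := cov_two hlerf hpos p.2 K (hF1 p hp).1 hK (hF1 p hp).2 hKi
    refine ⟨(fun q => (p.1 * q.1, q.2)) '' E, hE.image _, ?_, ?_⟩
    · rintro _ ⟨q, hq, rfl⟩
      exact hE1 q hq
    · rintro _ ⟨h, hh, k, hk, rfl⟩
      obtain ⟨q, hq, hqm⟩ := hE2 _ ⟨h, hh, k, hk, rfl⟩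
      refine ⟨_, ⟨q, hq, rfl⟩, ?_⟩
      simpa [mul_assoc] using hqm
  · rintro _ ⟨a, ha, k, hk, rfl⟩
    obtain ⟨p, hp, hpa⟩ := hF2 a ha
    exact ⟨p, hp, _, hpa, k, hk, by group⟩

lemma cov_product (hlerf : IsLERF G) (hpos : 0 < rankGradient G) (n : ℕ)
    (H : Fin n → Subgroup G) (hHfg : ∀ i, (H i).FG) (hHi : ∀ i, (H i).index = 0) :
    Cov (productSet H) := by
  induction n with
  | zero =>
    refine ⟨{(1, ⊥)}, Set.finite_singleton _, ?_, ?_⟩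
    · rintro p rfl
      refine ⟨⟨∅, by simp⟩, ?_⟩
      by_contra hne
      have h1 := gradient_le hpos (⊥ : Subgroup G) ⟨hne⟩ ∅ (by simp)
      have h2 : 0 ≤ rankGradient G * (⊥ : Subgroup G).index :=
        mul_nonneg hpos.le (Nat.cast_nonneg _)
      simp at h1
      simp at h2
      linarith
    · rintro a ⟨f, -, rfl⟩
      exact ⟨_, rfl, by simp⟩
  | succ n ih =>
    have h := Cov.mul hlerf hpos (ih (fun i => H i.castSucc) (fun i => hHfg _) (fun i => hHi _))
      (H (Fin.last n)) (hHfg _) (hHi _)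
    obtain ⟨F, hF, hF1, hF2⟩ := h
    refine ⟨F, hF, hF1, ?_⟩
    rintro _ ⟨f, hf, rfl⟩
    refine hF2 _ ⟨_, ⟨fun i => f i.castSucc, fun i => hf _, rfl⟩, f (Fin.last n), hf _, ?_⟩
    rw [List.ofFn_succ']
    simp

end RG

theorem stmt_2 {G : Type u} [Group G] (hfg : Group.FG G) (hlerf : IsLERF G)
    (hrg : 0 < rankGradient G) (n : ℕ) (H : Fin n → Subgroup G)
    (hHfg : ∀ i, (H i).FG) (hHi : ∀ i, (H i).index = 0) :
    productSet H ≠ Set.univ := by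
  intro huniv
  obtain ⟨F, hF, hF1, hF2⟩ := RG.cov_product hlerf hrg n H hHfg hHi
  have hcov : ⋃ p ∈ hF.toFinset, p.1 • (p.2 : Set G) = Set.univ := by
    rw [Set.eq_univ_iff_forall]
    intro x
    obtain ⟨p, hp, hx⟩ := hF2 x (huniv ▸ Set.mem_univ x)
    simp only [Set.mem_iUnion]
    exact ⟨p, hF.mem_toFinset.2 hp, Set.mem_smul_set_iff_inv_smul_mem.2 hx⟩
  obtain ⟨p, hp, hpf⟩ := Subgroup.exists_finiteIndex_of_leftCoset_cover hcov
  exact hpf.index_ne_zero (hF1 p (hF.mem_toFinset.1 hp)).2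
end

section
/- Let G be a finitely generated LERF group with positive rank gradient. Then there exists a transitive right action of G on a set X such that: (1) only finitely many elements g of G act trivially on X; and (2) for every finitely generated subgroup L of infinite index in G and every x ∈ X, the orbit xL is finite. -/
open scoped Pointwise

universe u

namespace RG

open Subgroup

variable {G : Type u} [Group G]

/-- positive rank gradient, in usable form -/
def PG (G : Type u) [Group G] (c : ℝ) : Prop :=
  0 < c ∧ ∀ S : Finset G, (closure (S : Set G)).index ≠ 0 →
    c * ((closure (S : Set G)).index : ℝ) ≤ S.card

lemma pg_of_rankGradient (h : 0 < rankGradient G) : PG G (rankGradient G) := by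
  refine ⟨h, fun S hS => ?_⟩
  have hpos : (0 : ℝ) < ((closure (S : Set G)).index : ℝ) := by
    exact_mod_cast Nat.pos_of_ne_zero hS
  have h1 : rankGradient G ≤ ((subgroupRank (closure (S : Set G)) : ℝ) - 1) /
      ((closure (S : Set G)).index : ℝ) := by
    apply csInf_le
    · refine ⟨-1, ?_⟩
      rintro r ⟨U, hU, rfl⟩
      have : (1 : ℝ) ≤ (U.index : ℝ) := by
        exact_mod_cast Nat.one_le_iff_ne_zero.mpr hU.index_ne_zero
      rw [le_div_iff₀ (by linarith)]
      have : (0 : ℝ) ≤ (subgroupRank U : ℝ) := Nat.cast_nonneg _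
      linarith
    · exact ⟨_, ⟨hS⟩, rfl⟩
  rw [le_div_iff₀ hpos] at h1
  have h2 : subgroupRank (closure (S : Set G)) ≤ S.card := Nat.sInf_le ⟨S, rfl, rfl⟩
  have h3 : (subgroupRank (closure (S : Set G)) : ℝ) ≤ S.card := by exact_mod_cast h2
  linarith

lemma relIndex_ne {U : Subgroup G} (hU : U.index ≠ 0) (L : Subgroup G) : U.relIndex L ≠ 0 :=
  fun h => hU (index_eq_zero_of_relIndex_eq_zero h)

lemma relIndex_le_index {U : Subgroup G} (hU : U.index ≠ 0) (L : Subgroup G) :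
    U.relIndex L ≤ U.index := by
  have := relIndex_le_of_le_right (H := U) (le_top : L ≤ ⊤) (by simpa using hU)
  simpa using this

lemma schreier (S : Finset G) (U : Subgroup G) (h : U.relIndex (closure (S : Set G)) ≠ 0) :
    ∃ T : Finset G, T.card ≤ U.relIndex (closure (S : Set G)) * S.card ∧
      closure (T : Set G) = U ⊓ closure (S : Set G) := by
  classical
  set L := closure (S : Set G) with hL
  have hSL : ∀ s ∈ S, s ∈ L := fun s hs => subset_closure hs
  let S' : Finset L := S.attach.image (fun s => ⟨s.1, hSL s.1 s.2⟩)
  have hS'c : S'.card ≤ S.card := by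
    refine Finset.card_image_le.trans ?_
    simp
  have hS'im : (L.subtype '' (S' : Set L)) = (S : Set G) := by
    ext x
    simp only [S', Set.mem_image, Finset.mem_coe, Finset.mem_image, Finset.mem_attach, true_and]
    constructor
    · rintro ⟨y, ⟨z, rfl⟩, rfl⟩
      exact z.2
    · intro hx
      exact ⟨⟨x, hSL x hx⟩, ⟨⟨x, hx⟩, rfl⟩, rfl⟩
  have hS' : closure (S' : Set L) = ⊤ := by
    apply map_injective L.subtype_injective
    rw [MonoidHom.map_closure, hS'im]
    rw [← MonoidHom.range_eq_map, range_subtype]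
  have : (U.subgroupOf L).FiniteIndex := ⟨h⟩
  obtain ⟨T, hT, hT2⟩ := exists_finset_card_le_mul (U.subgroupOf L) hS'
  refine ⟨T.image (L.subtype.comp (U.subgroupOf L).subtype), ?_, ?_⟩
  · refine Finset.card_image_le.trans (hT.trans ?_)
    exact Nat.mul_le_mul_left _ hS'c
  · have h3 := congrArg (Subgroup.map (L.subtype.comp (U.subgroupOf L).subtype)) hT2
    rw [MonoidHom.map_closure, ← Subgroup.map_map, ← MonoidHom.range_eq_map, range_subtype,
      subgroupOf_map_subtype] at h3
    rw [← h3, Finset.coe_image]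

lemma exists_large (hl : IsLERF G) {H : Subgroup G} (hH : H.FG) (hi : H.index = 0) (n : ℕ) :
    ∃ U : Subgroup G, H ≤ U ∧ U.index ≠ 0 ∧ n ≤ U.index := by
  induction n with
  | zero => exact ⟨⊤, le_top, by simp, by simp⟩
  | succ n ih =>
    obtain ⟨U, hHU, hU, hn⟩ := ih
    obtain ⟨𝒮, h𝒮, hS⟩ := hl H hH
    have : ∃ V ∈ 𝒮, ¬ U ≤ V := by
      by_contra! hcon
      have : U ≤ H := by rw [hS]; exact le_sInf hcon
      have : U = H := le_antisymm this hHU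
      exact hU (this ▸ hi)
    obtain ⟨V, hV, hUV⟩ := this
    have hHV : H ≤ V := by rw [hS]; exact sInf_le hV
    have hne : (U ⊓ V).index ≠ 0 := index_inf_ne_zero hU (h𝒮 V hV).index_ne_zero
    have : (U ⊓ V).FiniteIndex := ⟨hne⟩
    have hlt : U ⊓ V < U := lt_of_le_of_ne inf_le_left (fun h => hUV (inf_eq_left.mp h))
    exact ⟨U ⊓ V, le_inf hHU hHV, hne, by have := index_strictAnti hlt; omega⟩

lemma exists_sep (hl : IsLERF G) {H : Subgroup G} (hH : H.FG) {g : G} (hg : g ∉ H) :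
    ∃ U : Subgroup G, H ≤ U ∧ U.index ≠ 0 ∧ g ∉ U := by
  obtain ⟨𝒮, h𝒮, hS⟩ := hl H hH
  rw [hS, mem_sInf] at hg
  push Not at hg
  obtain ⟨V, hV, hgV⟩ := hg
  exact ⟨V, by rw [hS]; exact sInf_le hV, (h𝒮 V hV).index_ne_zero, hgV⟩

lemma exists_res (hl : IsLERF G) (N : Subgroup G) (n : ℕ) :
    ∃ V : Subgroup G, V.index ≠ 0 ∧ (n ≤ V.relIndex N ∨ V ⊓ N = ⊥) := by
  induction n with
  | zero => exact ⟨⊤, by simp, Or.inl (by simp)⟩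
  | succ n ih =>
    obtain ⟨V, hV, h | h⟩ := ih
    swap
    · exact ⟨V, hV, Or.inr h⟩
    by_cases hb : V ⊓ N = ⊥
    · exact ⟨V, hV, Or.inr hb⟩
    obtain ⟨x, hx, hx1⟩ := (Subgroup.ne_bot_iff_exists_ne_one.mp hb : ∃ a : ↥(V ⊓ N), a ≠ 1) |>.elim
      (fun a ha => (⟨a.1, a.2, fun h => ha (Subtype.ext h)⟩ : ∃ x, x ∈ V ⊓ N ∧ x ≠ 1))
    obtain ⟨W, -, hW, hxW⟩ := exists_sep hl (H := ⊥) Subgroup.FG.bot (g := x) (by simpa using hx1)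
    have hne : (W ⊓ V).index ≠ 0 := index_inf_ne_zero hW hV
    refine ⟨W ⊓ V, hne, Or.inl ?_⟩
    rw [← relIndex_inf_mul_relIndex]
    have h1 : W.relIndex (V ⊓ N) ≠ 0 := relIndex_ne hW _
    have h2 : W.relIndex (V ⊓ N) ≠ 1 := fun h => hxW (relIndex_eq_one.mp h hx)
    have h3 : 0 < V.relIndex N := Nat.pos_of_ne_zero (relIndex_ne hV _)
    have h4 : 2 ≤ W.relIndex (V ⊓ N) := by omega
    nlinarith

lemma relIndex_sup_le (U₀ H N : Subgroup G) [N.Normal] (hN : N ≤ U₀) (hi : N.index ≠ 0) :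
    U₀.relIndex (H ⊔ N) ≤ U₀.relIndex H := by
  have h1 : N.relIndex (U₀ ⊓ (H ⊔ N)) * U₀.relIndex (H ⊔ N) = N.relIndex (H ⊔ N) := by
    rw [relIndex_inf_mul_relIndex, inf_eq_left.mpr hN]
  have h2 : N.relIndex (U₀ ⊓ H) * U₀.relIndex H = N.relIndex H := by
    rw [relIndex_inf_mul_relIndex, inf_eq_left.mpr hN]
  rw [relIndex_sup_right, ← h2] at h1
  have h3 : N.relIndex (U₀ ⊓ H) ≤ N.relIndex (U₀ ⊓ (H ⊔ N)) :=
    relIndex_le_of_le_right (inf_le_inf_left _ le_sup_left) (relIndex_ne hi _)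
  have h4 : 0 < N.relIndex (U₀ ⊓ (H ⊔ N)) := Nat.pos_of_ne_zero (relIndex_ne hi _)
  refine Nat.le_of_mul_le_mul_left ?_ h4
  rw [h1]
  exact Nat.mul_le_mul_right _ h3

lemma small_ratio_aux (U₀ H L N : Subgroup G) [N.Normal] (hN : N ≤ U₀) (hi : N.index ≠ 0) :
    (H ⊔ N).relIndex L * U₀.index ≤ U₀.relIndex L * U₀.relIndex H * (H ⊔ N).index := by
  have hN0 : ∀ {A : Subgroup G}, N ≤ A → A.index ≠ 0 := fun hA h =>
    hi (by rw [← relIndex_mul_index hA, h, mul_zero])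
  have hU : (H ⊔ N).index ≠ 0 := hN0 le_sup_right
  have hU₀ := hN0 hN
  set U := H ⊔ N with hUdef
  have hUU : (U ⊓ U₀).index ≠ 0 := index_inf_ne_zero hU hU₀
  have h1 : U.relIndex L ≤ U.relIndex U₀ * U₀.relIndex L := by
    calc U.relIndex L ≤ (U ⊓ U₀).relIndex L := relIndex_le_of_le_left inf_le_left (relIndex_ne hUU _)
      _ = U.relIndex (U₀ ⊓ L) * U₀.relIndex L := (relIndex_inf_mul_relIndex _ _ _).symm
      _ ≤ _ := Nat.mul_le_mul_right _ (relIndex_le_of_le_right inf_le_left (relIndex_ne hU _))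
  have h2 : U.relIndex U₀ * U₀.index = U₀.relIndex U * U.index := by
    have a := relIndex_mul_index (H := U ⊓ U₀) (K := U₀) inf_le_right
    have b := relIndex_mul_index (H := U ⊓ U₀) (K := U) inf_le_left
    rw [inf_relIndex_right] at a
    rw [inf_relIndex_left] at b
    rw [a, b]
  have h3 : U₀.relIndex U ≤ U₀.relIndex H := relIndex_sup_le U₀ H N hN hi
  calc U.relIndex L * U₀.index ≤ U.relIndex U₀ * U₀.relIndex L * U₀.index :=
        Nat.mul_le_mul_right _ h1
    _ = U₀.relIndex L * (U.relIndex U₀ * U₀.index) := by ring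
    _ = U₀.relIndex L * (U₀.relIndex U * U.index) := by rw [h2]
    _ ≤ U₀.relIndex L * (U₀.relIndex H * U.index) := by gcongr
    _ = _ := by ring

lemma small_ratio (hl : IsLERF G) {c : ℝ} (hc : PG G c) (SH SL : Finset G)
    (hH : (closure (SH : Set G)).index = 0) (hL : (closure (SL : Set G)).index = 0)
    {ε : ℝ} (hε : 0 < ε) :
    ∃ U : Subgroup G, closure (SH : Set G) ≤ U ∧ U.index ≠ 0 ∧
      (U.relIndex (closure (SL : Set G)) : ℝ) < ε * U.index := by
  classical
  obtain ⟨hc0, hc⟩ := hc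
  by_contra! hcon
  set H := closure (SH : Set G) with hHd
  set L := closure (SL : Set G) with hLd
  have hce : 0 < c * ε := mul_pos hc0 hε
  obtain ⟨n, hn⟩ := exists_nat_gt ((2 * SH.card + 2 * SL.card : ℝ) / (c * ε))
  rw [div_lt_iff₀ hce] at hn
  obtain ⟨U, hHU, hU, hun⟩ := exists_large hl (H := H) ⟨SH, rfl⟩ hH n
  obtain ⟨V, hLV, hV, hvn⟩ := exists_large hl (H := L) ⟨SL, rfl⟩ hL n
  obtain ⟨T1, hT1, hT1c⟩ := schreier SH V (relIndex_ne hV _)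
  obtain ⟨T2, hT2, hT2c⟩ := schreier SL U (relIndex_ne hU _)
  have hTc : closure ((T1 ∪ T2 : Finset G) : Set G) = (V ⊓ H) ⊔ (U ⊓ L) := by
    rw [Finset.coe_union, Subgroup.closure_union, hT1c, hT2c]
  set K := (V ⊓ H) ⊔ (U ⊓ L) with hK
  have hKUV : K ≤ U ⊓ V := sup_le (le_inf (inf_le_right.trans hHU) inf_le_left)
    (le_inf inf_le_left (inf_le_right.trans hLV))
  have hKi : K.index = 0 := by
    by_contra hKi
    have h1 := hc (T1 ∪ T2) (by rw [hTc]; exact hKi)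
    rw [hTc] at h1
    have h2 : (T1 ∪ T2).card ≤ V.index * SH.card + U.index * SL.card := by
      refine (Finset.card_union_le _ _).trans (Nat.add_le_add (hT1.trans ?_) (hT2.trans ?_))
      · exact Nat.mul_le_mul_right _ (relIndex_le_index hV _)
      · exact Nat.mul_le_mul_right _ (relIndex_le_index hU _)
    have h3 : U.relIndex L * V.index ≤ K.index := by
      calc U.relIndex L * V.index ≤ U.relIndex V * V.index :=
            Nat.mul_le_mul_right _ (relIndex_le_of_le_right hLV (relIndex_ne hU _))
        _ = (U ⊓ V).index := by
            rw [← inf_relIndex_right, relIndex_mul_index inf_le_right]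
        _ ≤ K.index := Nat.le_of_dvd (Nat.pos_of_ne_zero hKi) (index_dvd_of_le hKUV)
    have h4 := hcon U hHU hU
    have h2' : ((T1 ∪ T2).card : ℝ) ≤ V.index * SH.card + U.index * SL.card := by
      exact_mod_cast h2
    have h3' : (U.relIndex L : ℝ) * V.index ≤ K.index := by exact_mod_cast h3
    have hu : (n : ℝ) ≤ U.index := by exact_mod_cast hun
    have hv : (n : ℝ) ≤ V.index := by exact_mod_cast hvn
    have hu0 : (0 : ℝ) < U.index := by exact_mod_cast Nat.pos_of_ne_zero hU
    have hv0 : (0 : ℝ) < V.index := by exact_mod_cast Nat.pos_of_ne_zero hV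
    have hx : (0 : ℝ) ≤ SH.card := Nat.cast_nonneg _
    have hy : (0 : ℝ) ≤ SL.card := Nat.cast_nonneg _
    have e1 : 2 * (SH.card : ℝ) < U.index * (c * ε) := by nlinarith
    have e2 : 2 * (SL.card : ℝ) < V.index * (c * ε) := by nlinarith
    have e3 := mul_lt_mul_of_pos_right e1 hv0
    have e4 := mul_lt_mul_of_pos_right e2 hu0
    have e5 : ε * U.index * V.index ≤ K.index :=
      (mul_le_mul_of_nonneg_right h4 hv0.le).trans h3'
    have e6 := mul_le_mul_of_nonneg_left e5 hc0.le
    nlinarith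
  obtain ⟨m, hm⟩ := exists_nat_gt ((U.relIndex L * V.relIndex H : ℝ) / ε)
  rw [div_lt_iff₀ hε] at hm
  obtain ⟨U₀, hKU₀, hU₀, htm⟩ := exists_large hl (H := K) ⟨T1 ∪ T2, hTc⟩ hKi m
  have : U₀.FiniteIndex := ⟨hU₀⟩
  have hNi : U₀.normalCore.index ≠ 0 := FiniteIndex.index_ne_zero
  have key := small_ratio_aux U₀ H L U₀.normalCore U₀.normalCore_le hNi
  set W := H ⊔ U₀.normalCore
  have hWi : W.index ≠ 0 := fun h => hNi (by
    rw [← relIndex_mul_index (le_sup_right : U₀.normalCore ≤ W), h, mul_zero])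
  have h5 := hcon W le_sup_left hWi
  have ha : U₀.relIndex L ≤ U.relIndex L := by
    rw [← inf_relIndex_right U L]
    exact relIndex_le_of_le_left (le_sup_right.trans hKU₀)
      (by rw [inf_relIndex_right]; exact relIndex_ne hU _)
  have hb : U₀.relIndex H ≤ V.relIndex H := by
    rw [← inf_relIndex_right V H]
    exact relIndex_le_of_le_left (le_sup_left.trans hKU₀)
      (by rw [inf_relIndex_right]; exact relIndex_ne hV _)
  have key2 : W.relIndex L * U₀.index ≤ U.relIndex L * V.relIndex H * W.index :=
    key.trans (by gcongr)
  have key3 : (W.relIndex L : ℝ) * U₀.index ≤ U.relIndex L * V.relIndex H * W.index := by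
    exact_mod_cast key2
  have hw0 : (0 : ℝ) < W.index := by exact_mod_cast Nat.pos_of_ne_zero hWi
  have ht0 : (0 : ℝ) < U₀.index := by exact_mod_cast Nat.pos_of_ne_zero hU₀
  have htm' : (m : ℝ) ≤ U₀.index := by exact_mod_cast htm
  have f1 : (U.relIndex L * V.relIndex H : ℝ) < U₀.index * ε := by nlinarith
  have f2 := mul_lt_mul_of_pos_right f1 hw0
  have f3 := mul_le_mul_of_nonneg_right h5 ht0.le
  nlinarith

lemma exists_join (hl : IsLERF G) {c : ℝ} (hc : PG G c) {H L : Subgroup G}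
    (hHf : H.FG) (hLf : L.FG) (hH : H.index = 0) (hL : L.index = 0) :
    ∃ U : Subgroup G, H ≤ U ∧ U.index ≠ 0 ∧ (H ⊔ (U ⊓ L)).index = 0 := by
  classical
  obtain ⟨SH, rfl⟩ := hHf
  obtain ⟨SL, rfl⟩ := hLf
  have hx : (0 : ℝ) ≤ SH.card := Nat.cast_nonneg _
  have hy : (0 : ℝ) ≤ SL.card := Nat.cast_nonneg _
  have hD : (0 : ℝ) < SH.card + SL.card + 1 := by linarith
  obtain ⟨U, hHU, hU, hr⟩ := small_ratio hl hc SH SL hH hL (div_pos hc.1 hD)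
  refine ⟨U, hHU, hU, ?_⟩
  obtain ⟨T, hT, hTc⟩ := schreier SL U (relIndex_ne hU _)
  have hcl : closure ((SH ∪ T : Finset G) : Set G) =
      closure (SH : Set G) ⊔ (U ⊓ closure (SL : Set G)) := by
    rw [Finset.coe_union, Subgroup.closure_union, hTc]
  by_contra hne
  have h1 := hc.2 (SH ∪ T) (by rw [hcl]; exact hne)
  have h2 : (SH ∪ T).card ≤ SH.card + U.relIndex (closure (SL : Set G)) * SL.card :=
    (Finset.card_union_le _ _).trans (by gcongr)
  have h3 : U.index ≤ (closure ((SH ∪ T : Finset G) : Set G)).index := by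
    rw [hcl]
    exact Nat.le_of_dvd (Nat.pos_of_ne_zero hne) (index_dvd_of_le (sup_le hHU inf_le_left))
  have h2' : ((SH ∪ T).card : ℝ) ≤ SH.card + U.relIndex (closure (SL : Set G)) * SL.card := by
    exact_mod_cast h2
  have h3' : (U.index : ℝ) ≤ (closure ((SH ∪ T : Finset G) : Set G)).index := by exact_mod_cast h3
  have h4 := mul_le_mul_of_nonneg_left h3' hc.1.le
  have h5 : (1 : ℝ) ≤ U.relIndex (closure (SL : Set G)) := by
    exact_mod_cast Nat.one_le_iff_ne_zero.mpr (relIndex_ne hU _)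
  rw [div_mul_eq_mul_div, lt_div_iff₀ hD] at hr
  nlinarith

lemma core_bound (hl : IsLERF G) {c : ℝ} (hc : PG G c) (SG : Finset G)
    (hSG : closure (SG : Set G) = ⊤) {B : ℕ} (hB : 2 * (SG.card : ℝ) / c ≤ B)
    {H N : Subgroup G} [N.Normal] (hNH : N ≤ H) (hHf : H.FG) (hH : H.index = 0) :
    Finite N ∧ Nat.card N ≤ B := by
  classical
  have main : ∀ V : Subgroup G, V.index ≠ 0 → V.relIndex N ≤ B := by
    intro V hV
    obtain ⟨SH, hSH⟩ := hHf
    obtain ⟨n, hn⟩ := exists_nat_gt ((2 * SH.card : ℝ) / c)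
    rw [div_lt_iff₀ hc.1] at hn
    obtain ⟨W, hHW, hW, hwn⟩ := exists_large hl (H := H) ⟨SH, hSH⟩ hH n
    set S := W ⊓ V with hSd
    have hS : S.index ≠ 0 := index_inf_ne_zero hW hV
    have hNS : (N ⊔ S).index ≠ 0 := fun h => hS (by
      rw [← relIndex_mul_index (le_sup_right : S ≤ N ⊔ S), h, mul_zero])
    obtain ⟨T, hT, hTc⟩ := schreier SG (N ⊔ S) (relIndex_ne hNS _)
    obtain ⟨Q, hQ, hQc⟩ := schreier SH S (relIndex_ne hS _)
    rw [hSG, relIndex_top_right] at hT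
    rw [hSG, inf_top_eq] at hTc
    rw [hSH] at hQ hQc
    have hdec : ∀ t : G, ∃ s : G, t ∈ N ⊔ S → s ∈ S ∧ t * s⁻¹ ∈ N := by
      intro t
      by_cases ht : t ∈ N ⊔ S
      · obtain ⟨y, hy, z, hz, rfl⟩ := mem_sup_of_normal_left.mp ht
        exact ⟨z, fun _ => ⟨hz, by simpa using hy⟩⟩
      · exact ⟨1, fun h => absurd h ht⟩
    choose f hf using hdec
    have hTm : ∀ t ∈ T, t ∈ N ⊔ S := fun t ht => by
      rw [← hTc]; exact subset_closure ht
    set P := closure ((Q ∪ T.image f : Finset G) : Set G) with hP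
    have hPc : P = (S ⊓ H) ⊔ closure ((T.image f : Finset G) : Set G) := by
      rw [hP, Finset.coe_union, Subgroup.closure_union, hQc]
    have hfS : closure ((T.image f : Finset G) : Set G) ≤ S := by
      rw [closure_le]
      intro x hx
      obtain ⟨t, ht, rfl⟩ := Finset.mem_image.mp (Finset.mem_coe.mp hx)
      exact (hf t (hTm t ht)).1
    have hPS : P = S := by
      apply le_antisymm
      · rw [hPc]
        exact sup_le inf_le_left hfS
      · intro x hx
        have h1 : N ⊔ S ≤ N ⊔ closure ((T.image f : Finset G) : Set G) := by
          rw [← hTc, closure_le]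
          intro t ht
          have h2 : t = (t * (f t)⁻¹) * f t := by group
          rw [h2]
          exact mul_mem (mem_sup_left (hf t (hTm t ht)).2)
            (mem_sup_right (subset_closure (Finset.mem_coe.mpr (Finset.mem_image_of_mem f ht))))
        obtain ⟨y, hy, z, hz, rfl⟩ := mem_sup_of_normal_left.mp (h1 (mem_sup_right hx))
        rw [hPc]
        have hyS : y ∈ S := by
          have := mul_mem hx (inv_mem (hfS hz))
          simpa using this
        exact mul_mem (mem_sup_left ⟨hyS, hNH hy⟩) (mem_sup_right hz)
    have h1 := hc.2 (Q ∪ T.image f) (by rw [← hP, hPS]; exact hS)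
    rw [← hP, hPS] at h1
    have h2 : (Q ∪ T.image f).card ≤ S.relIndex W * SH.card + (N ⊔ S).index * SG.card := by
      refine (Finset.card_union_le _ _).trans (Nat.add_le_add (hQ.trans ?_)
        (Finset.card_image_le.trans hT))
      exact Nat.mul_le_mul_right _ (relIndex_le_of_le_right hHW (relIndex_ne hS _))
    have h3 : S.relIndex W * W.index = S.index := relIndex_mul_index inf_le_left
    have h4 : S.relIndex (N ⊔ S) * (N ⊔ S).index = S.index := relIndex_mul_index le_sup_right
    have h5 : V.relIndex N ≤ S.relIndex (N ⊔ S) :=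
      (relIndex_le_of_le_left inf_le_right (relIndex_ne hS _)).trans
        (relIndex_le_of_le_right le_sup_left (relIndex_ne hS _))
    have h2' : ((Q ∪ T.image f).card : ℝ) ≤
        S.relIndex W * SH.card + (N ⊔ S).index * SG.card := by exact_mod_cast h2
    have h3' : (S.relIndex W : ℝ) * W.index = S.index := by exact_mod_cast h3
    have h4' : (S.relIndex (N ⊔ S) : ℝ) * (N ⊔ S).index = S.index := by exact_mod_cast h4
    have hw : (n : ℝ) ≤ W.index := by exact_mod_cast hwn
    have hr0 : (0 : ℝ) < S.relIndex W := by
      exact_mod_cast Nat.pos_of_ne_zero (relIndex_ne hS _)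
    have hq0 : (0 : ℝ) < (N ⊔ S).index := by exact_mod_cast Nat.pos_of_ne_zero hNS
    have e1 : 2 * (SH.card : ℝ) < W.index * c := by nlinarith [hc.1]
    have e2 := mul_lt_mul_of_pos_left e1 hr0
    have e3 : c * (S.index : ℝ) < 2 * ((N ⊔ S).index * SG.card) := by
      have : (S.relIndex W : ℝ) * (W.index * c) = c * S.index := by rw [← h3']; ring
      nlinarith
    rw [← h4'] at e3
    have e4 : c * (S.relIndex (N ⊔ S) : ℝ) < 2 * SG.card := by
      refine lt_of_mul_lt_mul_right ?_ hq0.le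
      nlinarith
    have e5 : (S.relIndex (N ⊔ S) : ℝ) ≤ B := by
      refine le_trans ?_ hB
      rw [le_div_iff₀ hc.1]
      linarith
    exact h5.trans (by exact_mod_cast e5)
  obtain ⟨V, hV, h | h⟩ := exists_res hl N (B + 1)
  · have := main V hV
    omega
  · have h1 := main V hV
    have h2 := relIndex_ne hV N
    rw [← inf_relIndex_right, h, relIndex_bot_left] at h1 h2
    exact ⟨Nat.finite_of_card_ne_zero h2, h1⟩

/-- states of the inductive construction -/
structure St (G : Type u) [Group G] where
  H : Subgroup G
  U : Subgroup G
  fg : H.FG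
  inf : H.index = 0
  le : H ≤ U
  fin : U.index ≠ 0

lemma step (hl : IsLERF G) {c : ℝ} (hc : PG G c) (s : St G) (p : Finset G × G) :
    ∃ s' : St G, s.H ≤ s'.H ∧ s'.U ≤ s.U ∧
      ((closure (p.1 : Set G)).index = 0 → s'.H.relIndex (closure (p.1 : Set G)) ≠ 0) ∧
      (p.2 ∈ s'.U.normalCore → p.2 ∈ s.H.normalCore) := by
  classical
  obtain ⟨S, g⟩ := p
  -- first shrink U
  have hsh : ∃ U' : Subgroup G, s.H ≤ U' ∧ U' ≤ s.U ∧ U'.index ≠ 0 ∧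
      (g ∈ U'.normalCore → g ∈ s.H.normalCore) := by
    by_cases hg : g ∈ s.H.normalCore
    · exact ⟨s.U, s.le, le_rfl, s.fin, fun _ => hg⟩
    · have : ∃ b : G, b * g * b⁻¹ ∉ s.H := by
        by_contra! hcon
        exact hg hcon
      obtain ⟨b, hb⟩ := this
      obtain ⟨V, hHV, hV, hbV⟩ := exists_sep hl s.fg hb
      exact ⟨s.U ⊓ V, le_inf s.le hHV, inf_le_left, index_inf_ne_zero s.fin hV,
        fun h => absurd (h b).2 hbV⟩
  obtain ⟨U', hHU', hU'U, hU', hcore⟩ := hsh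
  by_cases hL : (closure (S : Set G)).index = 0
  · obtain ⟨U, hHU, hU, hj⟩ := exists_join hl hc s.fg ⟨S, rfl⟩ s.inf hL
    have hUU : (U ⊓ U').index ≠ 0 := index_inf_ne_zero hU hU'
    obtain ⟨T, -, hT⟩ := schreier S (U ⊓ U') (relIndex_ne hUU _)
    refine ⟨⟨s.H ⊔ ((U ⊓ U') ⊓ closure (S : Set G)), U', s.fg.sup ⟨T, hT⟩, ?_, ?_, hU'⟩,
      le_sup_left, hU'U, fun _ => ?_, hcore⟩
    · have hle : s.H ⊔ ((U ⊓ U') ⊓ closure (S : Set G)) ≤ s.H ⊔ (U ⊓ closure (S : Set G)) :=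
        sup_le_sup_left (inf_le_inf_right _ inf_le_left) _
      rw [← relIndex_mul_index hle, hj, mul_zero]
    · exact sup_le hHU' (inf_le_left.trans inf_le_right)
    · intro h0
      have := relIndex_eq_zero_of_le_left
        (le_sup_right : (U ⊓ U') ⊓ closure (S : Set G) ≤ s.H ⊔ ((U ⊓ U') ⊓ closure (S : Set G))) h0
      rw [inf_relIndex_right] at this
      exact relIndex_ne hUU _ this
  · exact ⟨⟨s.H, U', s.fg, s.inf, hHU', hU'⟩, le_rfl, hU'U, fun h => absurd h hL, hcore⟩

lemma exists_subgroup (hfg : Group.FG G) (hl : IsLERF G) {c : ℝ} (hc : PG G c) :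
    ∃ H : Subgroup G, (H.normalCore : Set G).Finite ∧
      ∀ L : Subgroup G, L.FG → L.index = 0 → H.relIndex L ≠ 0 := by
  classical
  obtain ⟨SG, hSG⟩ := hfg.out
  have hcount : Countable G := by
    have := Group.fg_iff_exists_freeGroup_hom_surjective_finite.mp hfg
    obtain ⟨α, hα, φ, hφ⟩ := this
    exact hφ.countable
  have hinf : (⊥ : Subgroup G).index = 0 := by
    by_contra h
    have := hc.2 ∅ (by simpa using h)
    simp only [Finset.coe_empty, Subgroup.closure_empty, Finset.card_empty, Nat.cast_zero] at this
    have h0 : (0 : ℝ) < ((⊥ : Subgroup G).index : ℝ) := by exact_mod_cast Nat.pos_of_ne_zero h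
    nlinarith [mul_pos hc.1 h0]
  obtain ⟨e, he⟩ := exists_surjective_nat (Finset G × G)
  choose nx hx1 hx2 hx3 hx4 using (step hl hc : ∀ (s : St G) (p : Finset G × G), _)
  let s : ℕ → St G := fun n => Nat.rec
    ⟨⊥, ⊤, Subgroup.FG.bot, hinf, bot_le, by simp⟩ (fun n s => nx s (e n)) n
  have hs : ∀ n, s (n + 1) = nx (s n) (e n) := fun n => rfl
  have hmono : Monotone (fun n => (s n).H) := monotone_nat_of_le_succ fun n => by
    simp only [hs]; exact hx1 _ _
  have hanti : Antitone (fun n => (s n).U) := antitone_nat_of_succ_le fun n => by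
    simp only [hs]; exact hx2 _ _
  have hle : ∀ n, (⨆ m, (s m).H) ≤ (s n).U := fun n => iSup_le fun m =>
    ((hmono (le_max_left m n)).trans (s (max m n)).le).trans (hanti (le_max_right m n))
  refine ⟨⨆ n, (s n).H, ?_, ?_⟩
  · obtain ⟨B, hB⟩ := exists_nat_ge (2 * (SG.card : ℝ) / c)
    have hcb : ∀ n, Finite (s n).H.normalCore ∧ Nat.card (s n).H.normalCore ≤ B := fun n =>
      core_bound hl hc SG hSG hB (s n).H.normalCore_le (s n).fg (s n).inf
    have hex : ∀ g ∈ (⨆ n, (s n).H).normalCore, ∃ n, g ∈ (s n).H.normalCore := by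
      intro g hg
      obtain ⟨n, hn⟩ := he (∅, g)
      refine ⟨n, ?_⟩
      have h1 := hx4 (s n) (e n)
      rw [← hs, hn] at h1
      exact h1 (normalCore_mono (hle (n + 1)) hg)
    by_contra hnf
    obtain ⟨T, hT, hTc⟩ := Set.Infinite.exists_subset_card_eq (hnf : Set.Infinite _) (B + 1)
    choose! k hk using hex
    have hTs : ∀ t ∈ T, t ∈ (s (T.sup k)).H.normalCore := fun t ht =>
      normalCore_mono (hmono (Finset.le_sup ht)) (hk t (hT ht))
    obtain ⟨hf, hcard⟩ := hcb (T.sup k)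
    have h1 : (T : Set G) ⊆ ((s (T.sup k)).H.normalCore : Set G) := hTs
    have h2 := Set.ncard_le_ncard h1 (Set.toFinite _)
    rw [Set.ncard_coe_finset, hTc] at h2
    have h3 : ((s (T.sup k)).H.normalCore : Set G).ncard = Nat.card (s (T.sup k)).H.normalCore :=
      rfl
    omega
  · rintro L ⟨S, rfl⟩ hL h0
    obtain ⟨n, hn⟩ := he (S, 1)
    have h1 := hx3 (s n) (e n)
    rw [← hs, hn] at h1
    exact h1 hL (relIndex_eq_zero_of_le_left (le_iSup (fun n => (s n).H) (n + 1)) h0)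

end RG

theorem stmt_3 {G : Type u} [Group G] (hfg : Group.FG G) (hlerf : IsLERF G)
    (hrg : 0 < rankGradient G) :
    ∃ (X : Type u) (act : X → G → X),
      (∀ x, act x 1 = x) ∧
      (∀ x g h, act (act x g) h = act x (g * h)) ∧
      (∀ x y : X, ∃ g : G, act x g = y) ∧
      {g : G | ∀ x : X, act x g = x}.Finite ∧
      (∀ L : Subgroup G, L.FG → L.index = 0 →
        ∀ x : X, {y : X | ∃ l ∈ L, act x l = y}.Finite) := by
  obtain ⟨H, hcore, hrel⟩ := RG.exists_subgroup hfg hlerf (RG.pg_of_rankGradient hrg)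
  refine ⟨G ⧸ H, fun x g => g⁻¹ • x, fun x => by simp, fun x g h => by simp [mul_smul], ?_, ?_, ?_⟩
  · intro x y
    obtain ⟨g, hg⟩ := MulAction.exists_smul_eq G x y
    exact ⟨g⁻¹, by simpa using hg⟩
  · refine hcore.subset fun g hg b => ?_
    have h1 := hg ((b⁻¹ : G) : G ⧸ H)
    have h2 : (((g⁻¹ * b⁻¹ : G)) : G ⧸ H) = ((b⁻¹ : G) : G ⧸ H) := h1
    rw [QuotientGroup.eq] at h2
    simpa [mul_assoc] using h2
  · intro L hL hLi x
    obtain ⟨a, rfl⟩ := QuotientGroup.mk_surjective x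
    let φ : G ≃* G := MulAut.conj a⁻¹
    let L' : Subgroup G := L.map (φ : G →* G)
    have hL'f : L'.FG := by
      classical
      obtain ⟨S, rfl⟩ := hL
      refine ⟨S.image (φ : G →* G), ?_⟩
      rw [Finset.coe_image, ← MonoidHom.map_closure]
    have hL'i : L'.index = 0 := by
      rw [← hLi]; exact Subgroup.index_map_equiv L φ
    have hr := hrel L' hL'f hL'i
    have hfin : Finite (L' ⧸ H.subgroupOf L') := Subgroup.index_ne_zero_iff_finite.mp hr
    let F : L' ⧸ H.subgroupOf L' → G ⧸ H := fun q => ((a * (q.out : G) : G) : G ⧸ H)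
    refine (Set.finite_range F).subset ?_
    rintro y ⟨l, hl, rfl⟩
    have hm : a⁻¹ * l⁻¹ * a ∈ L' := ⟨l⁻¹, inv_mem hl, by simp [φ]⟩
    refine ⟨QuotientGroup.mk ⟨_, hm⟩, ?_⟩
    have h1 : (QuotientGroup.mk (Quotient.out (QuotientGroup.mk ⟨_, hm⟩ : L' ⧸ H.subgroupOf L')) :
        L' ⧸ H.subgroupOf L') = QuotientGroup.mk ⟨_, hm⟩ := Quotient.out_eq' _
    rw [QuotientGroup.eq, Subgroup.mem_subgroupOf] at h1
    change ((_ : G) : G ⧸ H) = ((l⁻¹ * a : G) : G ⧸ H)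
    rw [QuotientGroup.eq]
    simpa [mul_assoc] using h1
end

section
/- Let G be a finitely generated LPF group with positive rank gradient, let n be a natural number, and let H₁, …, Hₙ be finitely generated subgroups of infinite index in G. Then the product set H₁H₂⋯Hₙ is a proper subset of G. -/
open scoped Pointwise

universe u

/-- Sets covered by finitely many left cosets of f.g. infinite index subgroups. -/
def SmallSet {G : Type u} [Group G] (S : Set G) : Prop :=
  ∃ T : Set (G × Subgroup G), T.Finite ∧ (∀ p ∈ T, p.2.FG ∧ p.2.index = 0) ∧
    ∀ x ∈ S, ∃ p ∈ T, p.1⁻¹ * x ∈ p.2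

theorem SmallSet.biUnion {G : Type u} [Group G] {ι : Type*} {s : Set ι} (hs : s.Finite)
    {A : ι → Set G} (hA : ∀ i ∈ s, SmallSet (A i)) {S : Set G}
    (hS : ∀ x ∈ S, ∃ i ∈ s, x ∈ A i) : SmallSet S := by
  choose! T hT using hA
  refine ⟨⋃ i ∈ s, T i, hs.biUnion fun i hi => (hT i hi).1, ?_, ?_⟩
  · intro p hp
    simp only [Set.mem_iUnion] at hp
    obtain ⟨i, hi, hp⟩ := hp
    exact (hT i hi).2.1 p hp
  · intro x hx
    obtain ⟨i, hi, hxi⟩ := hS x hx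
    obtain ⟨p, hp, h⟩ := (hT i hi).2.2 x hxi
    exact ⟨p, by simp only [Set.mem_iUnion]; exact ⟨i, hi, hp⟩, h⟩

theorem SmallSet.translate {G : Type u} [Group G] {A S : Set G} (hA : SmallSet A) (g : G)
    (hS : ∀ x ∈ S, g⁻¹ * x ∈ A) : SmallSet S := by
  obtain ⟨T, hT, h1, h2⟩ := hA
  refine ⟨(fun p : G × Subgroup G => (g * p.1, p.2)) '' T, hT.image _, ?_, ?_⟩
  · rintro _ ⟨p, hp, rfl⟩
    exact h1 p hp
  · intro x hx
    obtain ⟨p, hp, h⟩ := h2 _ (hS x hx)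
    exact ⟨_, ⟨p, hp, rfl⟩, by simpa [mul_assoc] using h⟩

/-- double translates `a L b` are small -/
theorem SmallSet.double {G : Type u} [Group G] (L : Subgroup G) (hL : L.FG) (hi : L.index = 0)
    (a b : G) : SmallSet {x : G | a⁻¹ * x * b⁻¹ ∈ L} := by
  refine ⟨{(a * b, L.map (MulAut.conj b⁻¹).toMonoidHom)}, Set.finite_singleton _, ?_, ?_⟩
  · rintro p rfl
    refine ⟨?_, ?_⟩
    · classical
      obtain ⟨S, hS⟩ := hL
      refine ⟨S.image (MulAut.conj b⁻¹).toMonoidHom, ?_⟩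
      rw [Finset.coe_image, ← MonoidHom.map_closure, hS]
    have := Subgroup.index_map_equiv L (MulAut.conj b⁻¹)
    exact this.trans hi
  · intro x hx
    refine ⟨_, rfl, ?_⟩
    refine ⟨_, hx, ?_⟩
    simp [mul_assoc]

theorem exists_reps {G : Type u} [Group G] (U K : Subgroup G) (hU : U.FiniteIndex) :
    ∃ R : Set G, R.Finite ∧ R ⊆ K ∧ ∀ k ∈ K, ∃ r ∈ R, r⁻¹ * k ∈ U := by
  have hf : Finite (G ⧸ U) := Subgroup.finite_quotient_of_finiteIndex
  have h : ∀ q ∈ ((fun g : G => (g : G ⧸ U)) '' (K : Set G)), ∃ r ∈ K, (r : G ⧸ U) = q := by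
    rintro q ⟨k, hk, rfl⟩
    exact ⟨k, hk, rfl⟩
  choose! f hf1 hf2 using h
  refine ⟨f '' ((fun g : G => (g : G ⧸ U)) '' (K : Set G)), (Set.toFinite _).image _, ?_, ?_⟩
  · rintro _ ⟨q, hq, rfl⟩
    exact hf1 q hq
  · intro k hk
    have hq : (k : G ⧸ U) ∈ ((fun g : G => (g : G ⧸ U)) '' (K : Set G)) := ⟨k, hk, rfl⟩
    exact ⟨_, ⟨_, hq, rfl⟩, QuotientGroup.eq.1 (hf2 _ hq)⟩

theorem gens_inf {G : Type u} [Group G] (U K : Subgroup G) (hU : U.FiniteIndex) (S : Finset G)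
    (hS : Subgroup.closure (S : Set G) = K) :
    ∃ T : Finset G, T.card ≤ U.relIndex K * S.card ∧
      Subgroup.closure (T : Set G) = U ⊓ K := by
  classical
  have hSK : (S : Set G) ⊆ K := hS ▸ Subgroup.subset_closure
  let S' : Finset K := S.subtype (· ∈ K)
  have hc : S'.card ≤ S.card := by
    rw [Finset.card_subtype]; exact Finset.card_filter_le _ _
  have hS' : Subgroup.closure (S' : Set K) = ⊤ := by
    apply Subgroup.map_injective K.subtype_injective
    rw [MonoidHom.map_closure, ← MonoidHom.range_eq_map, Subgroup.range_subtype]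
    convert hS using 2
    ext x
    simp only [Set.mem_image, S']
    constructor
    · rintro ⟨y, hy, rfl⟩
      simpa using hy
    · intro hx
      exact ⟨⟨x, hSK hx⟩, by simpa using hx, rfl⟩
  obtain ⟨T, hT1, hT2⟩ := Subgroup.exists_finset_card_le_mul (U.subgroupOf K) hS'
  let f : (U.subgroupOf K) →* G := K.subtype.comp (U.subgroupOf K).subtype
  refine ⟨T.image f, Finset.card_image_le.trans (hT1.trans ?_), ?_⟩
  · exact Nat.mul_le_mul_left _ hc
  · rw [Finset.coe_image, ← MonoidHom.map_closure, hT2, ← Subgroup.map_map,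
      ← MonoidHom.range_eq_map, Subgroup.range_subtype, Subgroup.subgroupOf_map_subtype]

theorem rank_bound {G : Type u} [Group G] (U : Subgroup G) (hU : U.FiniteIndex) (S : Finset G)
    (hS : Subgroup.closure (S : Set G) = U) :
    rankGradient G * U.index + 1 ≤ S.card := by
  have h1 : rankGradient G ≤ ((subgroupRank U : ℝ) - 1) / (U.index : ℝ) := by
    apply csInf_le
    · refine ⟨-1, ?_⟩
      rintro r ⟨V, hV, rfl⟩
      have : (1 : ℝ) ≤ V.index := by
        exact_mod_cast Nat.one_le_iff_ne_zero.2 hV.index_ne_zero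
      rw [le_div_iff₀ (by linarith)]
      have : (0 : ℝ) ≤ subgroupRank V := Nat.cast_nonneg _
      linarith
    · exact ⟨U, hU, rfl⟩
  have h2 : (subgroupRank U : ℝ) ≤ S.card := by
    have : subgroupRank U ≤ S.card := Nat.sInf_le ⟨S, rfl, hS⟩
    exact_mod_cast this
  have : (1 : ℝ) ≤ U.index := by
    exact_mod_cast Nat.one_le_iff_ne_zero.2 hU.index_ne_zero
  rw [le_div_iff₀ (by linarith)] at h1
  linarith

theorem index_zero_of_le {G : Type u} [Group G] {H K : Subgroup G} (h : H ≤ K)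
    (hK : K.index = 0) : H.index = 0 := by
  have := Subgroup.index_dvd_of_le h
  rw [hK] at this
  exact Nat.eq_zero_of_zero_dvd this

theorem smallSet_mul {G : Type u} [Group G] (hlpf : IsLPF G) (hrg : 0 < rankGradient G)
    (H K : Subgroup G) (hH : H.FG) (hK : K.FG) (hHi : H.index = 0) (hKi : K.index = 0) :
    SmallSet {x : G | ∃ h ∈ H, ∃ k ∈ K, x = h * k} := by
  classical
  obtain ⟨SH, hSH⟩ := hH
  obtain ⟨SK, hSK⟩ := id hK
  set c := rankGradient G with hc
  -- first finite index subgroup, containing `K`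
  obtain ⟨N, hN⟩ := exists_nat_gt (((SK.card : ℝ) + 1) / c)
  obtain ⟨U₀, hKU, hU₀, hNU⟩ := hlpf K hK hKi N
  have hcU : (SK.card : ℝ) + 1 ≤ c * U₀.index := by
    rw [div_lt_iff₀ hrg] at hN
    have : (N : ℝ) ≤ U₀.index := by exact_mod_cast hNU
    nlinarith
  obtain ⟨T, -, hT⟩ := gens_inf U₀ H hU₀ SH hSH
  -- second finite index subgroup, containing `U₀ ⊓ H`
  obtain ⟨V, hHV, hV, hVi⟩ := hlpf (U₀ ⊓ H) ⟨T, hT⟩ (index_zero_of_le inf_le_right hHi)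
    ((T.card + 1) * U₀.index)
  have hU : (V ⊓ U₀).FiniteIndex := ⟨Subgroup.index_inf_ne_zero hV.index_ne_zero hU₀.index_ne_zero⟩
  set U := V ⊓ U₀ with hUdef
  have hm : U.relIndex U₀ * U₀.index = U.index := Subgroup.relIndex_mul_index inf_le_right
  have hVU : V.index ≤ U.index := 
    Nat.le_of_dvd (Nat.pos_of_ne_zero hU.index_ne_zero) (Subgroup.index_dvd_of_le inf_le_left)
  have hmT : T.card + 1 ≤ U.relIndex U₀ := by
    have h0 : 0 < U₀.index := Nat.pos_of_ne_zero hU₀.index_ne_zero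
    exact Nat.le_of_mul_le_mul_right (by omega) h0
  obtain ⟨T', hT'c, hT'⟩ := gens_inf U K hU SK hSK
  have hrel : U.relIndex K ≤ U.relIndex U₀ := by
    apply Subgroup.relIndex_le_of_le_right hKU
    intro h
    omega
  set L := (U₀ ⊓ H) ⊔ (U ⊓ K) with hL
  have hLgen : Subgroup.closure ((T ∪ T' : Finset G) : Set G) = L := by
    rw [Finset.coe_union, Subgroup.closure_union, hT, hT']
  have hLU : L ≤ U := sup_le (le_inf hHV inf_le_left) inf_le_left
  have hLi : L.index = 0 := by
    by_contra hne
    have hb := rank_bound L ⟨hne⟩ _ hLgen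
    have h1 : ((T ∪ T').card : ℝ) ≤ T.card + U.relIndex U₀ * SK.card := by
      have := Finset.card_union_le T T'
      have h2 : U.relIndex K * SK.card ≤ U.relIndex U₀ * SK.card := Nat.mul_le_mul_right _ hrel
      exact_mod_cast (by omega : (T ∪ T').card ≤ T.card + U.relIndex U₀ * SK.card)
    have h3 : (U.relIndex U₀ : ℝ) * U₀.index ≤ L.index := by
      have := Nat.le_of_dvd (Nat.pos_of_ne_zero hne) (Subgroup.index_dvd_of_le hLU)
      rw [← hm] at this
      exact_mod_cast this
    have h4 : (T.card : ℝ) + 1 ≤ U.relIndex U₀ := by exact_mod_cast hmT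
    have h5 : c * ((U.relIndex U₀ : ℝ) * U₀.index) ≤ c * L.index :=
      mul_le_mul_of_nonneg_left h3 hrg.le
    have h6 : (U.relIndex U₀ : ℝ) * (SK.card + 1) ≤ U.relIndex U₀ * (c * U₀.index) :=
      mul_le_mul_of_nonneg_left hcU (Nat.cast_nonneg _)
    nlinarith
  obtain ⟨R, hR, hRH, hRc⟩ := exists_reps U₀ H hU₀
  obtain ⟨R', hR', hRK, hRc'⟩ := exists_reps U K hU
  refine SmallSet.biUnion (s := R ×ˢ R') (hR.prod hR')
    (A := fun p => {x : G | p.1⁻¹ * x * (p.2⁻¹)⁻¹ ∈ L})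
    (fun p _ => SmallSet.double L ⟨_, hLgen⟩ hLi p.1 p.2⁻¹) ?_
  rintro x ⟨h, hh, k, hk, rfl⟩
  obtain ⟨r, hr, hrh⟩ := hRc h hh
  obtain ⟨r', hr', hrk⟩ := hRc' k⁻¹ (inv_mem hk)
  refine ⟨(r, r'), ⟨hr, hr'⟩, ?_⟩
  have e1 : r⁻¹ * h ∈ L := (le_sup_left : U₀ ⊓ H ≤ L) 
    (Subgroup.mem_inf.2 ⟨hrh, H.mul_mem (H.inv_mem (hRH hr)) hh⟩)
  have e2 : k * r' ∈ L := (le_sup_right : U ⊓ K ≤ L)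
    (Subgroup.mem_inf.2 ⟨by simpa using U.inv_mem hrk, K.mul_mem hk (hRK hr')⟩)
  have := mul_mem e1 e2
  simpa [mul_assoc] using this

theorem not_small_univ {G : Type u} [Group G] : ¬ SmallSet (Set.univ : Set G) := by
  rintro ⟨T, hT, h1, h2⟩
  obtain ⟨p, hp, hf⟩ := Subgroup.exists_finiteIndex_of_leftCoset_cover
    (s := hT.toFinset) (g := fun p : G × Subgroup G => p.1) (H := fun p => p.2) (by
      refine Set.eq_univ_of_forall fun x => ?_
      obtain ⟨p, hp, h⟩ := h2 x trivial
      simp only [Set.mem_iUnion]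
      exact ⟨p, by simpa using hp, (mem_leftCoset_iff _).2 h⟩)
  exact hf.index_ne_zero (h1 p (by simpa using hp)).2

theorem small_productSet {G : Type u} [Group G] (hlpf : IsLPF G) (hrg : 0 < rankGradient G)
    (n : ℕ) (H : Fin n → Subgroup G)
    (hHfg : ∀ i, (H i).FG) (hHi : ∀ i, (H i).index = 0) : SmallSet (productSet H) := by
  induction n with
  | zero =>
    refine ⟨{(1, ⊥)}, Set.finite_singleton _, ?_, ?_⟩
    · rintro p rfl
      refine ⟨Subgroup.FG.bot, ?_⟩
      by_contra hne
      have := rank_bound (⊥ : Subgroup G) ⟨hne⟩ ∅ (by simp)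
      have h2 : 0 ≤ rankGradient G * ((⊥ : Subgroup G).index : ℝ) := by positivity
      simp only [Finset.card_empty, Nat.cast_zero] at this
      linarith
    · rintro x ⟨f, hf, rfl⟩
      exact ⟨_, rfl, by simp⟩
  | succ n ih =>
    obtain ⟨T, hT, h1, h2⟩ := ih (fun i => H i.castSucc) (fun i => hHfg _) (fun i => hHi _)
    refine SmallSet.biUnion hT
      (A := fun p => {x : G | ∃ h ∈ p.2, ∃ k ∈ H (Fin.last n), p.1⁻¹ * x = h * k}) ?_ ?_
    · intro p hp
      exact (smallSet_mul hlpf hrg p.2 (H (Fin.last n)) (h1 p hp).1 (hHfg _) (h1 p hp).2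
        (hHi _)).translate p.1 (fun x hx => hx)
    · rintro x ⟨f, hf, rfl⟩
      obtain ⟨p, hp, h⟩ := h2 (List.ofFn fun i : Fin n => f i.castSucc).prod
        ⟨_, fun i => hf _, rfl⟩
      refine ⟨p, hp, _, h, f (Fin.last n), hf _, ?_⟩
      rw [List.ofFn_succ', List.concat_eq_append, List.prod_append, List.prod_singleton, mul_assoc]

theorem stmt_11 {G : Type u} [Group G] (hfg : Group.FG G) (hlpf : IsLPF G)
    (hrg : 0 < rankGradient G) (n : ℕ) (H : Fin n → Subgroup G)
    (hHfg : ∀ i, (H i).FG) (hHi : ∀ i, (H i).index = 0) :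
    productSet H ≠ Set.univ := by
  intro h
  exact not_small_univ (h ▸ small_productSet hlpf hrg n H hHfg hHi)
end
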